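/- arXiv:2502.10716 — 3 statements merged into one kernel-verified Lean document; each statement's English description precedes it below -/
import Mathlib

section
/- Let μ and ν be probability measures on a product measurable space X × Y, let g : X → Z and h : Z → S be measurable maps, and let ℓ : S × Y → ℝ be measurable with 0 ≤ ℓ(s, y) ≤ L for all (s, y), where L > 0. Define Φ : X × Y → Z × Y by Φ(x, y) = (g(x), y). Then ∫ ℓ(h(g(x)), y) dμ(x, y) ≤ ∫ ℓ(h(g(x)), y) dν(x, y) + √2 · L · d_{1/2}(Φ_#μ, Φ_#ν), where Φ_#μ denotes the pushforward of μ under Φ. -/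
open MeasureTheory

/-- Hellinger distance between two measures:
`d_{1/2}(μ, ν) = (2 ∫ (√(dμ/dλ) − √(dν/dλ))² dλ)^{1/2}` with `λ = μ + ν`. -/
noncomputable def hellingerDist {Ω : Type*} [MeasurableSpace Ω] (μ ν : Measure Ω) : ℝ :=
  Real.sqrt (2 * ∫ ω, (Real.sqrt ((μ.rnDeriv (μ + ν) ω).toReal)
      - Real.sqrt ((ν.rnDeriv (μ + ν) ω).toReal)) ^ 2 ∂(μ + ν))

theorem hell_aux {Ω : Type*} [MeasurableSpace Ω] (μ ν : Measure Ω)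
    [IsProbabilityMeasure μ] [IsProbabilityMeasure ν] (f : Ω → ℝ) (hf : Measurable f)
    (L : ℝ) (hL : 0 < L) (hfb : ∀ x, 0 ≤ f x ∧ f x ≤ L) :
    ∫ x, f x ∂μ ≤ ∫ x, f x ∂ν + Real.sqrt 2 * L * hellingerDist μ ν := by
  have hμ : μ ≪ μ + ν := Measure.absolutelyContinuous_of_le (Measure.le_add_right le_rfl)
  have hν : ν ≪ μ + ν := Measure.absolutelyContinuous_of_le (Measure.le_add_left le_rfl)
  unfold hellingerDist
  have e1 := integral_rnDeriv_smul hμ (f := f)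
  have e2 := integral_rnDeriv_smul hν (f := f)
  have i1 : Integrable (fun x => (μ.rnDeriv (μ + ν) x).toReal) (μ + ν) :=
    Measure.integrable_toReal_rnDeriv
  have i2 : Integrable (fun x => (ν.rnDeriv (μ + ν) x).toReal) (μ + ν) :=
    Measure.integrable_toReal_rnDeriv
  have t1 : ∫ x, (μ.rnDeriv (μ + ν) x).toReal ∂(μ + ν) = 1 := by
    rw [Measure.integral_toReal_rnDeriv hμ]; simp
  have t2 : ∫ x, (ν.rnDeriv (μ + ν) x).toReal ∂(μ + ν) = 1 := by
    rw [Measure.integral_toReal_rnDeriv hν]; simp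
  have m1 : Measurable (fun x => (μ.rnDeriv (μ + ν) x).toReal) :=
    (Measure.measurable_rnDeriv _ _).ennreal_toReal
  have m2 : Measurable (fun x => (ν.rnDeriv (μ + ν) x).toReal) :=
    (Measure.measurable_rnDeriv _ _).ennreal_toReal
  have p1 : ∀ x, 0 ≤ (μ.rnDeriv (μ + ν) x).toReal := fun x => ENNReal.toReal_nonneg
  have p2 : ∀ x, 0 ≤ (ν.rnDeriv (μ + ν) x).toReal := fun x => ENNReal.toReal_nonneg
  rw [← e1, ← e2]
  simp only [smul_eq_mul]
  generalize μ + ν = l at *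
  set p := fun x => (μ.rnDeriv l x).toReal with hp
  set q := fun x => (ν.rnDeriv l x).toReal with hq
  change ∫ x, p x * f x ∂l ≤ ∫ x, q x * f x ∂l +
    √2 * L * √(2 * ∫ x, (√(p x) - √(q x)) ^ 2 ∂l)
  change ∀ x, 0 ≤ p x at p1
  change ∀ x, 0 ≤ q x at p2
  have j1 : Integrable (fun x => p x * f x) l :=
    i1.mul_bdd (c := L) hf.aestronglyMeasurable
      (Filter.Eventually.of_forall fun x => by
        rw [Real.norm_eq_abs, abs_of_nonneg (hfb x).1]; exact (hfb x).2)
  have j2 : Integrable (fun x => q x * f x) l :=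
    i2.mul_bdd (c := L) hf.aestronglyMeasurable
      (Filter.Eventually.of_forall fun x => by
        rw [Real.norm_eq_abs, abs_of_nonneg (hfb x).1]; exact (hfb x).2)
  have ia : Integrable (fun x => (√(p x) - √(q x)) ^ 2) l := by
    refine (i1.add i2).mono' ((m1.sqrt.sub m2.sqrt).pow_const 2).aestronglyMeasurable
      (Filter.Eventually.of_forall fun x => ?_)
    rw [Real.norm_eq_abs, abs_of_nonneg (sq_nonneg _)]
    change _ ≤ p x + q x
    nlinarith [Real.sq_sqrt (p1 x), Real.sq_sqrt (p2 x),
      mul_nonneg (Real.sqrt_nonneg (p x)) (Real.sqrt_nonneg (q x))]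
  set H := ∫ x, (√(p x) - √(q x)) ^ 2 ∂l with hH
  have hH0 : 0 ≤ H := integral_nonneg fun x => sq_nonneg _
  set D := ∫ x, p x * f x ∂l - ∫ x, q x * f x ∂l with hD
  have key : ∀ t : ℝ, 0 ≤ (L ^ 2 * H) * (t * t) + (-2 * D) * t + 4 := by
    intro t
    have h0 : ∫ x, (2 * t) * (p x * f x - q x * f x) ∂l ≤
        ∫ x, ((t ^ 2 * L ^ 2) * (√(p x) - √(q x)) ^ 2 + 2 * (p x + q x)) ∂l := by
      refine integral_mono ((j1.sub j2).const_mul _)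
        ((ia.const_mul _).add ((i1.add i2).const_mul 2)) fun x => ?_
      change (2 * t) * (p x * f x - q x * f x) ≤
        (t ^ 2 * L ^ 2) * (√(p x) - √(q x)) ^ 2 + 2 * (p x + q x)
      have hx := hfb x
      have s1 := Real.sq_sqrt (p1 x)
      have s2 := Real.sq_sqrt (p2 x)
      generalize √(p x) = a at *
      generalize √(q x) = b at *
      rw [← s1, ← s2]
      have h3 : f x ^ 2 ≤ L ^ 2 := pow_le_pow_left₀ hx.1 hx.2 2
      have h4 := mul_le_mul_of_nonneg_left h3 (sq_nonneg (t * (a - b)))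
      nlinarith [sq_nonneg (t * f x * (a - b) - (a + b)), sq_nonneg (a - b)]
    have i12 : Integrable (fun x => 2 * (p x + q x)) l := (i1.add i2).const_mul 2
    rw [integral_const_mul, integral_sub j1 j2,
      integral_add (ia.const_mul _) i12, integral_const_mul,
      integral_const_mul, integral_add i1 i2, t1, t2] at h0
    rw [← hH, ← hD] at h0
    nlinarith
  have hd := discrim_le_zero key
  unfold discrim at hd
  have hfin : D ≤ 2 * L * √H := by
    apply le_of_abs_le; apply abs_le_of_sq_le_sq _ (by positivity)
    rw [mul_pow, Real.sq_sqrt hH0]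
    nlinarith
  have : √2 * L * √(2 * H) = 2 * L * √H := by
    rw [Real.sqrt_mul (by norm_num)]
    linear_combination L * √H * Real.mul_self_sqrt (show (0:ℝ) ≤ 2 by norm_num)
  rw [this]
  linarith

/-- Theorem A.10: the target loss is upper-bounded by the source loss plus `√2 · L` times
the Hellinger distance between the pushed-forward representation-label distributions. -/
theorem loss_le_loss_add_hellinger
    {X Y Z S : Type*} [MeasurableSpace X] [MeasurableSpace Y]
    [MeasurableSpace Z] [MeasurableSpace S]
    (μ ν : Measure (X × Y)) [IsProbabilityMeasure μ] [IsProbabilityMeasure ν]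
    (g : X → Z) (hg : Measurable g) (h : Z → S) (hh : Measurable h)
    (ℓ : S × Y → ℝ) (hℓmeas : Measurable ℓ)
    (L : ℝ) (hL : 0 < L) (hℓ : ∀ s y, 0 ≤ ℓ (s, y) ∧ ℓ (s, y) ≤ L) :
    ∫ p, ℓ (h (g p.1), p.2) ∂μ
      ≤ ∫ p, ℓ (h (g p.1), p.2) ∂ν
        + Real.sqrt 2 * L *
          hellingerDist (Measure.map (fun p : X × Y => (g p.1, p.2)) μ)
            (Measure.map (fun p : X × Y => (g p.1, p.2)) ν) := by
  have hΦ : Measurable (fun p : X × Y => (g p.1, p.2)) :=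
    (hg.comp measurable_fst).prodMk measurable_snd
  have hf : Measurable (fun z : Z × Y => ℓ (h z.1, z.2)) :=
    hℓmeas.comp ((hh.comp measurable_fst).prodMk measurable_snd)
  have := Measure.isProbabilityMeasure_map (μ := μ) hΦ.aemeasurable
  have := Measure.isProbabilityMeasure_map (μ := ν) hΦ.aemeasurable
  have := hell_aux (Measure.map (fun p : X × Y => (g p.1, p.2)) μ)
    (Measure.map (fun p : X × Y => (g p.1, p.2)) ν) _ hf L hL (fun z => hℓ _ _)
  rwa [integral_map hΦ.aemeasurable hf.aestronglyMeasurable,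
    integral_map hΦ.aemeasurable hf.aestronglyMeasurable] at this
end

section
/- Let C ≥ 1 and let μ, μ' be probability measures on a measurable space X. Let p, p' : X → ℝ^C be measurable maps into probability vectors (the conditional label distributions of the two domains), and define the label marginals P_Y, P'_Y ∈ ℝ^C by (P_Y)_i = ∫ p(x)_i dμ(x) and (P'_Y)_i = ∫ p'(x)_i dμ'(x). Let g : X → Z be measurable and h : Z → ℝ^C be measurable into probability vectors, and set f = h∘g. Define the Hellinger loss L_{Hel}(f, μ, p) = ∫ [2 ∑_{i=1}^C (√(f(x)_i) − √(p(x)_i))²] dμ(x), and similarly L_{Hel}(f, μ', p'). Then d_{1/2}(P_Y, P'_Y) ≤ L_{Hel}(f, μ, p)^{1/2} + d_{1/2}(g_#μ, g_#μ') + L_{Hel}(f, μ', p')^{1/2}, where g_#μ denotes the pushforward of μ under g. -/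
open MeasureTheory

/-- Hellinger distance between probability vectors on `{1,…,C}`:
`d_{1/2}(a, b) = (2 ∑ i, (√a_i − √b_i)²)^{1/2}`. -/
noncomputable def hellingerVec {C : ℕ} (a b : Fin C → ℝ) : ℝ :=
  Real.sqrt (2 * ∑ i, (Real.sqrt (a i) - Real.sqrt (b i)) ^ 2)

/-- Hellinger loss of a simplex-valued hypothesis `f` with respect to feature
distribution `μ` and conditional label map `p`. -/
noncomputable def hellingerLoss {C : ℕ} {X : Type*} [MeasurableSpace X]
    (f : X → Fin C → ℝ) (μ : Measure X) (p : X → Fin C → ℝ) : ℝ :=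
  ∫ x, (2 * ∑ i, (Real.sqrt (f x i) - Real.sqrt (p x i)) ^ 2) ∂μ

lemma hel_key_int {Ω : Type*} [MeasurableSpace Ω] (ν : Measure Ω) (a b : Ω → ℝ)
    (ha : Integrable a ν) (hb : Integrable b ν) (ha0 : ∀ x, 0 ≤ a x) (hb0 : ∀ x, 0 ≤ b x) :
    Integrable (fun x => (Real.sqrt (a x) - Real.sqrt (b x)) ^ 2) ν ∧
    (Real.sqrt (∫ x, a x ∂ν) - Real.sqrt (∫ x, b x ∂ν)) ^ 2
      ≤ ∫ x, (Real.sqrt (a x) - Real.sqrt (b x)) ^ 2 ∂ν := by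
  have hA : MemLp (fun x => Real.sqrt (a x)) 2 ν := by
    rw [memLp_two_iff_integrable_sq (Real.continuous_sqrt.comp_aestronglyMeasurable ha.1)]
    exact ha.congr (Filter.Eventually.of_forall fun x => (Real.sq_sqrt (ha0 x)).symm)
  have hB : MemLp (fun x => Real.sqrt (b x)) 2 ν := by
    rw [memLp_two_iff_integrable_sq (Real.continuous_sqrt.comp_aestronglyMeasurable hb.1)]
    exact hb.congr (Filter.Eventually.of_forall fun x => (Real.sq_sqrt (hb0 x)).symm)
  have hAB : Integrable (fun x => Real.sqrt (a x) * Real.sqrt (b x)) ν := hA.integrable_mul hB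
  have e : ∀ x, (Real.sqrt (a x) - Real.sqrt (b x)) ^ 2
      = a x + b x - 2 * (Real.sqrt (a x) * Real.sqrt (b x)) := fun x => by
    have h1 := Real.sq_sqrt (ha0 x)
    have h2 := Real.sq_sqrt (hb0 x)
    linear_combination h1 + h2
  have cs : ∫ x, Real.sqrt (a x) * Real.sqrt (b x) ∂ν
      ≤ Real.sqrt (∫ x, a x ∂ν) * Real.sqrt (∫ x, b x ∂ν) := by
    have := integral_mul_le_Lp_mul_Lq_of_nonneg (μ := ν) (p := 2) (q := 2)
      Real.HolderConjugate.two_two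
      (f := fun x => Real.sqrt (a x)) (g := fun x => Real.sqrt (b x))
      (Filter.Eventually.of_forall fun x => Real.sqrt_nonneg _)
      (Filter.Eventually.of_forall fun x => Real.sqrt_nonneg _)
      (by simpa using hA) (by simpa using hB)
    simp only [Real.rpow_two, Real.sq_sqrt (ha0 _), Real.sq_sqrt (hb0 _)] at this
    rwa [← Real.sqrt_eq_rpow, ← Real.sqrt_eq_rpow] at this
  constructor
  · simp_rw [e]
    exact (ha.add hb).sub (hAB.const_mul 2)
  · simp_rw [e]
    rw [integral_sub (show Integrable (fun x => a x + b x) ν from ha.add hb) (hAB.const_mul 2), integral_add ha hb, integral_const_mul]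
    have h1 := Real.sq_sqrt (integral_nonneg (μ := ν) ha0)
    have h2 := Real.sq_sqrt (integral_nonneg (μ := ν) hb0)
    nlinarith

lemma hellingerVec_eq {C : ℕ} (a b : Fin C → ℝ) : hellingerVec a b = Real.sqrt 2 *
    dist (WithLp.toLp 2 (fun i => Real.sqrt (a i)) : EuclideanSpace ℝ (Fin C))
      (WithLp.toLp 2 (fun i => Real.sqrt (b i))) := by
  rw [hellingerVec, Real.sqrt_mul (by norm_num), EuclideanSpace.dist_eq]
  simp [Real.dist_eq, sq_abs]

lemma hellingerVec_tri {C : ℕ} (a b c : Fin C → ℝ) :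
    hellingerVec a c ≤ hellingerVec a b + hellingerVec b c := by
  simp only [hellingerVec_eq, ← mul_add]
  exact mul_le_mul_of_nonneg_left (dist_triangle _ _ _) (Real.sqrt_nonneg _)

lemma hellingerVec_symm {C : ℕ} (a b : Fin C → ℝ) :
    hellingerVec a b = hellingerVec b a := by
  simp only [hellingerVec_eq, dist_comm]

lemma simplex_int {C : ℕ} {X : Type*} [MeasurableSpace X] (μ : Measure X) [IsFiniteMeasure μ]
    (p : X → Fin C → ℝ) (hpm : ∀ i, Measurable fun x => p x i)
    (hp0 : ∀ x i, 0 ≤ p x i) (hp1 : ∀ x, ∑ i, p x i = 1) (i : Fin C) :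
    Integrable (fun x => p x i) μ := by
  refine Integrable.of_bound (hpm i).aestronglyMeasurable 1 (Filter.Eventually.of_forall fun x => ?_)
  rw [Real.norm_of_nonneg (hp0 x i), ← hp1 x]
  exact Finset.single_le_sum (fun j _ => hp0 x j) (Finset.mem_univ i)

lemma hel_loss_bound {C : ℕ} {X : Type*} [MeasurableSpace X] (μ : Measure X) [IsFiniteMeasure μ]
    (p f : X → Fin C → ℝ) (hpm : ∀ i, Measurable fun x => p x i)
    (hp0 : ∀ x i, 0 ≤ p x i) (hp1 : ∀ x, ∑ i, p x i = 1)
    (hfm : ∀ i, Measurable fun x => f x i)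
    (hf0 : ∀ x i, 0 ≤ f x i) (hf1 : ∀ x, ∑ i, f x i = 1) :
    hellingerVec (fun i => ∫ x, f x i ∂μ) (fun i => ∫ x, p x i ∂μ)
      ≤ Real.sqrt (hellingerLoss f μ p) := by
  have K := fun i => hel_key_int μ (fun x => f x i) (fun x => p x i)
    (simplex_int μ f hfm hf0 hf1 i) (simplex_int μ p hpm hp0 hp1 i)
    (fun x => hf0 x i) (fun x => hp0 x i)
  unfold hellingerVec hellingerLoss
  apply Real.sqrt_le_sqrt
  rw [integral_const_mul, integral_finsetSum _ (fun i _ => (K i).1)]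
  exact mul_le_mul_of_nonneg_left (Finset.sum_le_sum fun i _ => (K i).2) (by norm_num)

lemma hel_dist_bound {C : ℕ} {Z : Type*} [MeasurableSpace Z] (μ ν : Measure Z)
    [IsFiniteMeasure μ] [IsFiniteMeasure ν]
    (h : Z → Fin C → ℝ) (hhm : ∀ i, Measurable fun x => h x i)
    (hh0 : ∀ x i, 0 ≤ h x i) (hh1 : ∀ x, ∑ i, h x i = 1) :
    hellingerVec (fun i => ∫ x, h x i ∂μ) (fun i => ∫ x, h x i ∂ν) ≤ hellingerDist μ ν := by
  have hμ : μ ≪ μ + ν := Measure.absolutelyContinuous_of_le (Measure.le_add_right le_rfl)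
  have hν : ν ≪ μ + ν := Measure.absolutelyContinuous_of_le (Measure.le_add_left le_rfl)
  have iμ := fun i => (integrable_rnDeriv_smul_iff hμ).2 (simplex_int μ h hhm hh0 hh1 i)
  have iν := fun i => (integrable_rnDeriv_smul_iff hν).2 (simplex_int ν h hhm hh0 hh1 i)
  have K := fun i => hel_key_int (μ + ν) _ _ (iμ i) (iν i)
    (fun x => mul_nonneg ENNReal.toReal_nonneg (hh0 x i))
    (fun x => mul_nonneg ENNReal.toReal_nonneg (hh0 x i))
  simp only [integral_rnDeriv_smul hμ, integral_rnDeriv_smul hν] at K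
  unfold hellingerVec hellingerDist
  apply Real.sqrt_le_sqrt
  refine mul_le_mul_of_nonneg_left ?_ (by norm_num)
  refine (Finset.sum_le_sum fun i _ => (K i).2).trans (le_of_eq ?_)
  rw [← integral_finsetSum _ (fun i _ => (K i).1)]
  refine integral_congr_ae (Filter.Eventually.of_forall fun x => ?_)
  simp only [smul_eq_mul]
  have : ∀ i, (√((μ.rnDeriv (μ + ν) x).toReal * h x i)
      - √((ν.rnDeriv (μ + ν) x).toReal * h x i)) ^ 2
      = (√((μ.rnDeriv (μ + ν) x).toReal) - √((ν.rnDeriv (μ + ν) x).toReal)) ^ 2 * h x i := by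
    intro i
    rw [Real.sqrt_mul ENNReal.toReal_nonneg, Real.sqrt_mul ENNReal.toReal_nonneg, ← sub_mul,
      mul_pow, Real.sq_sqrt (hh0 x i)]
  simp_rw [this]
  rw [← Finset.mul_sum, hh1, mul_one]

/-- Theorem A.11 (the lower-bound trade-off of Theorem 4.1): the Hellinger distance between
the label marginals of two domains is bounded by the square roots of the Hellinger losses
plus the Hellinger distance between the pushed-forward representation distributions. -/
theorem label_marginal_hellinger_tradeoff
    (C : ℕ) (hC : 1 ≤ C) {X Z : Type*} [MeasurableSpace X] [MeasurableSpace Z]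
    (μ μ' : Measure X) [IsProbabilityMeasure μ] [IsProbabilityMeasure μ']
    (p p' : X → Fin C → ℝ)
    (hpm : ∀ i, Measurable fun x => p x i) (hp'm : ∀ i, Measurable fun x => p' x i)
    (hp0 : ∀ x i, 0 ≤ p x i) (hp1 : ∀ x, ∑ i, p x i = 1)
    (hp'0 : ∀ x i, 0 ≤ p' x i) (hp'1 : ∀ x, ∑ i, p' x i = 1)
    (g : X → Z) (hg : Measurable g)
    (h : Z → Fin C → ℝ) (hhm : ∀ i, Measurable fun z => h z i)
    (hh0 : ∀ z i, 0 ≤ h z i) (hh1 : ∀ z, ∑ i, h z i = 1) :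
    hellingerVec (fun i => ∫ x, p x i ∂μ) (fun i => ∫ x, p' x i ∂μ')
      ≤ Real.sqrt (hellingerLoss (fun x => h (g x)) μ p)
        + hellingerDist (Measure.map g μ) (Measure.map g μ')
        + Real.sqrt (hellingerLoss (fun x => h (g x)) μ' p') := by
  have fm : ∀ i, Measurable fun x => h (g x) i := fun i => (hhm i).comp hg
  have : IsProbabilityMeasure (Measure.map g μ) := Measure.isProbabilityMeasure_map hg.aemeasurable
  have : IsProbabilityMeasure (Measure.map g μ') := Measure.isProbabilityMeasure_map hg.aemeasurable
  have A := hel_loss_bound μ p (fun x => h (g x)) hpm hp0 hp1 fm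
    (fun x => hh0 (g x)) (fun x => hh1 (g x))
  have B := hel_loss_bound μ' p' (fun x => h (g x)) hp'm hp'0 hp'1 fm
    (fun x => hh0 (g x)) (fun x => hh1 (g x))
  have D := hel_dist_bound (Measure.map g μ) (Measure.map g μ') h hhm hh0 hh1
  simp only [fun i => integral_map (μ := μ) hg.aemeasurable (hhm i).aestronglyMeasurable,
    fun i => integral_map (μ := μ') hg.aemeasurable (hhm i).aestronglyMeasurable] at D
  rw [hellingerVec_symm] at A
  have T1 := hellingerVec_tri (fun i => ∫ x, p x i ∂μ) (fun i => ∫ x, h (g x) i ∂μ)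
    (fun i => ∫ x, p' x i ∂μ')
  have T2 := hellingerVec_tri (fun i => ∫ x, h (g x) i ∂μ) (fun i => ∫ x, h (g x) i ∂μ')
    (fun i => ∫ x, p' x i ∂μ')
  linarith
end

section
/- Let μ and ν be probability measures on a product measurable space X × Y, let {A_m}_{m∈M} be a countable measurable partition of X such that μ(A_m × Y) > 0 and ν(A_m × Y) > 0 for every m, and set π_m = μ(A_m × Y), μ_m = μ|_{A_m × Y}, ν_m = ν|_{A_m × Y}. Let g : X → Z and h : Z → S be measurable, f = h∘g, let ℓ : S × Y → ℝ be measurable with 0 ≤ ℓ ≤ L, and let Φ(x, y) = (g(x), y). Then L(f, μ) ≤ ∑_{m∈M} π_m · L(f, ν_m) + √2 · L · ∑_{m∈M} π_m · d_{1/2}(Φ_#μ_m, Φ_#ν_m), where L(f, P) = E_{(x,y)∼P}[ℓ(f(x), y)]. -/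
open MeasureTheory ProbabilityTheory

theorem hell_aux_s9 {Ω : Type*} [MeasurableSpace Ω] (lam : Measure Ω) (p q φ : Ω → ℝ)
    (hφ : Measurable φ)
    (L : ℝ) (hL : 0 < L) (h0 : ∀ x, 0 ≤ φ x) (h1 : ∀ x, φ x ≤ L)
    (ip : Integrable p lam) (iq : Integrable q lam)
    (tp : ∫ x, p x ∂lam = 1) (tq : ∫ x, q x ∂lam = 1)
    (mp : Measurable p) (mq : Measurable q) (np : ∀ x, 0 ≤ p x) (nq : ∀ x, 0 ≤ q x) :
    ∫ x, p x * φ x ∂lam ≤ ∫ x, q x * φ x ∂lam + Real.sqrt 2 * L *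
      Real.sqrt (2 * ∫ x, (Real.sqrt (p x) - Real.sqrt (q x)) ^ 2 ∂lam)
      ∧ Real.sqrt (2 * ∫ x, (Real.sqrt (p x) - Real.sqrt (q x)) ^ 2 ∂lam) ≤ 2 := by
  have hb : ∀ x, (Real.sqrt (p x) - Real.sqrt (q x)) ^ 2 ≤ p x + q x := by
    intro x
    nlinarith [Real.sq_sqrt (np x), Real.sq_sqrt (nq x),
      mul_nonneg (Real.sqrt_nonneg (p x)) (Real.sqrt_nonneg (q x))]
  have iI : Integrable (fun x => (Real.sqrt (p x) - Real.sqrt (q x)) ^ 2) lam := by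
    refine (ip.add iq).mono' ?_ (ae_of_all _ fun x => ?_)
    · exact ((mp.sqrt.sub mq.sqrt).pow_const 2).aestronglyMeasurable
    · rw [Real.norm_of_nonneg (sq_nonneg _)]; exact hb x
  have ipφ : Integrable (fun x => p x * φ x) lam := by
    refine (ip.mul_const L).mono' (mp.mul hφ).aestronglyMeasurable (ae_of_all _ fun x => ?_)
    rw [Real.norm_of_nonneg (mul_nonneg (np x) (h0 x))]
    exact mul_le_mul_of_nonneg_left (h1 x) (np x)
  have iqφ : Integrable (fun x => q x * φ x) lam := by
    refine (iq.mul_const L).mono' (mq.mul hφ).aestronglyMeasurable (ae_of_all _ fun x => ?_)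
    rw [Real.norm_of_nonneg (mul_nonneg (nq x) (h0 x))]
    exact mul_le_mul_of_nonneg_left (h1 x) (nq x)
  have I0 : 0 ≤ ∫ x, (Real.sqrt (p x) - Real.sqrt (q x)) ^ 2 ∂lam :=
    integral_nonneg fun x => sq_nonneg _
  have I2 : ∫ x, (Real.sqrt (p x) - Real.sqrt (q x)) ^ 2 ∂lam ≤ 2 := by
    have h := integral_mono iI (ip.add iq) hb
    have e : ∫ x, (p + q) x ∂lam = 2 := by
      rw [integral_add' ip iq, tp, tq]; norm_num
    linarith
  have key : ∀ s : ℝ, 0 < s → ∫ x, p x * φ x ∂lam ≤ ∫ x, q x * φ x ∂lam +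
      (L / s * ∫ x, (Real.sqrt (p x) - Real.sqrt (q x)) ^ 2 ∂lam + L * s) := by
    intro s hs
    have j1 : Integrable (fun x => L / s * (Real.sqrt (p x) - Real.sqrt (q x)) ^ 2) lam :=
      iI.const_mul _
    have j2 : Integrable (fun x => L * s / 2 * (p x + q x)) lam := (ip.add iq).const_mul _
    have j3 : Integrable (fun x => L / s * (Real.sqrt (p x) - Real.sqrt (q x)) ^ 2
      + L * s / 2 * (p x + q x)) lam := j1.add j2
    have h := integral_mono (μ := lam) (f := fun x => p x * φ x)
      (g := fun x => q x * φ x + (L / s * (Real.sqrt (p x) - Real.sqrt (q x)) ^ 2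
        + L * s / 2 * (p x + q x))) ipφ
      (iqφ.add j3) ?_
    · rw [integral_add iqφ j3,
        integral_add j1 j2, integral_const_mul,
        integral_const_mul, integral_add ip iq, tp, tq] at h
      linarith
    · intro x
      show p x * φ x ≤ q x * φ x + (L / s * (Real.sqrt (p x) - Real.sqrt (q x)) ^ 2
        + L * s / 2 * (p x + q x))
      have ea := Real.sq_sqrt (np x)
      have eb := Real.sq_sqrt (nq x)
      have ha := Real.sqrt_nonneg (p x)
      have hb := Real.sqrt_nonneg (q x)
      generalize Real.sqrt (p x) = a at *
      generalize Real.sqrt (q x) = b at *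
      rw [← ea, ← eb]
      have k1 : (a ^ 2 - b ^ 2) * φ x ≤ L * (|a - b| * (a + b)) := by
        have e : |a ^ 2 - b ^ 2| = |a - b| * (a + b) := by
          rw [show a ^ 2 - b ^ 2 = (a - b) * (a + b) by ring, abs_mul,
            abs_of_nonneg (add_nonneg ha hb)]
        calc (a ^ 2 - b ^ 2) * φ x ≤ |a ^ 2 - b ^ 2| * φ x :=
              mul_le_mul_of_nonneg_right (le_abs_self _) (h0 x)
          _ ≤ |a ^ 2 - b ^ 2| * L := mul_le_mul_of_nonneg_left (h1 x) (abs_nonneg _)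
          _ = _ := by rw [e]; ring
      have k2 : |a - b| * (a + b) ≤ (a - b) ^ 2 / s + s / 2 * (a ^ 2 + b ^ 2) := by
        rw [← sq_abs (a - b)]
        have hab : (a + b) ^ 2 ≤ 2 * (a ^ 2 + b ^ 2) := by nlinarith [sq_nonneg (a - b)]
        have : |a - b| ^ 2 / s + s / 4 * (a + b) ^ 2 - |a - b| * (a + b)
          = (|a - b| - s / 2 * (a + b)) ^ 2 / s := by field_simp; ring
        have h3 : 0 ≤ (|a - b| - s / 2 * (a + b)) ^ 2 / s := by positivity
        nlinarith
      have k3 := mul_le_mul_of_nonneg_left k2 hL.le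
      have : L * ((a - b) ^ 2 / s + s / 2 * (a ^ 2 + b ^ 2)) = L / s * (a - b) ^ 2
        + L * s / 2 * (a ^ 2 + b ^ 2) := by ring
      linarith
  generalize ∫ x, (Real.sqrt (p x) - Real.sqrt (q x)) ^ 2 ∂lam = I at *
  constructor
  · have e : Real.sqrt 2 * L * Real.sqrt (2 * I) = 2 * L * Real.sqrt I := by
      rw [Real.sqrt_mul (by norm_num)]
      have := Real.mul_self_sqrt (show (0:ℝ) ≤ 2 by norm_num)
      linear_combination L * Real.sqrt I * this
    rw [e]
    refine le_of_forall_pos_le_add fun ε hε => ?_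
    have hr := Real.sqrt_nonneg I
    have hI := Real.sq_sqrt I0
    have hs : 0 < Real.sqrt I + ε / L := by positivity
    have k := key _ hs
    have : L / (Real.sqrt I + ε / L) * I ≤ L * Real.sqrt I := by
      rw [div_mul_eq_mul_div, div_le_iff₀ hs]
      have : 0 ≤ L * Real.sqrt I * (ε / L) := by positivity
      nlinarith
    have e2 : L * (Real.sqrt I + ε / L) = L * Real.sqrt I + ε := by field_simp
    linarith
  · rw [Real.sqrt_le_left (by norm_num)]; linarith

theorem hell_facts {Ω : Type*} [MeasurableSpace Ω] (P Q : Measure Ω)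
    [IsProbabilityMeasure P] [IsProbabilityMeasure Q] (φ : Ω → ℝ) (hφ : Measurable φ)
    (L : ℝ) (hL : 0 < L) (h0 : ∀ x, 0 ≤ φ x) (h1 : ∀ x, φ x ≤ L) :
    ∫ x, φ x ∂P ≤ ∫ x, φ x ∂Q + Real.sqrt 2 * L * hellingerDist P Q
      ∧ hellingerDist P Q ≤ 2 := by
  have hP : P ≪ P + Q := Measure.absolutelyContinuous_of_le (Measure.le_add_right le_rfl)
  have hQ : Q ≪ P + Q := Measure.absolutelyContinuous_of_le (Measure.le_add_left le_rfl)
  have eP : ∫ x, φ x ∂P = ∫ x, (P.rnDeriv (P+Q) x).toReal * φ x ∂(P+Q) := by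
    have := integral_rnDeriv_smul (f := φ) hP
    simpa [smul_eq_mul] using this.symm
  have eQ : ∫ x, φ x ∂Q = ∫ x, (Q.rnDeriv (P+Q) x).toReal * φ x ∂(P+Q) := by
    have := integral_rnDeriv_smul (f := φ) hQ
    simpa [smul_eq_mul] using this.symm
  unfold hellingerDist
  rw [eP, eQ]
  exact hell_aux_s9 (P + Q) (fun x => (P.rnDeriv (P+Q) x).toReal)
    (fun x => (Q.rnDeriv (P+Q) x).toReal) φ hφ L hL h0 h1
    Measure.integrable_toReal_rnDeriv Measure.integrable_toReal_rnDeriv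
    (by rw [Measure.integral_toReal_rnDeriv hP]; simp)
    (by rw [Measure.integral_toReal_rnDeriv hQ]; simp)
    (Measure.measurable_rnDeriv _ _).ennreal_toReal
    (Measure.measurable_rnDeriv _ _).ennreal_toReal
    (fun x => ENNReal.toReal_nonneg) (fun x => ENNReal.toReal_nonneg)

/-- Single pair-of-domains subspace bound from the proof of Theorem 5.2(i): the loss of
one domain is bounded by the subspace losses on another domain plus the subspace-wise
Hellinger alignment terms. -/
theorem loss_le_subspace_losses_add_subspace_hellinger
    {X Y Z S : Type*} [MeasurableSpace X] [MeasurableSpace Y]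
    [MeasurableSpace Z] [MeasurableSpace S]
    (μ ν : Measure (X × Y)) [IsProbabilityMeasure μ] [IsProbabilityMeasure ν]
    {M : Type*} [Countable M] (A : M → Set X)
    (hAmeas : ∀ m, MeasurableSet (A m))
    (hdisj : Pairwise (Function.onFun Disjoint A))
    (hcover : ⋃ m, A m = Set.univ)
    (hμpos : ∀ m, 0 < μ (A m ×ˢ (Set.univ : Set Y)))
    (hνpos : ∀ m, 0 < ν (A m ×ˢ (Set.univ : Set Y)))
    (g : X → Z) (hg : Measurable g) (h : Z → S) (hh : Measurable h)
    (ℓ : S × Y → ℝ) (hℓmeas : Measurable ℓ)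
    (L : ℝ) (hL : 0 < L) (hℓ : ∀ s y, 0 ≤ ℓ (s, y) ∧ ℓ (s, y) ≤ L) :
    ∫ q, ℓ (h (g q.1), q.2) ∂μ
      ≤ (∑' m, (μ (A m ×ˢ (Set.univ : Set Y))).toReal *
            ∫ q, ℓ (h (g q.1), q.2) ∂(ν[|A m ×ˢ (Set.univ : Set Y)]))
        + Real.sqrt 2 * L *
          ∑' m, (μ (A m ×ˢ (Set.univ : Set Y))).toReal *
            hellingerDist
              (Measure.map (fun q : X × Y => (g q.1, q.2)) (μ[|A m ×ˢ (Set.univ : Set Y)]))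
              (Measure.map (fun q : X × Y => (g q.1, q.2)) (ν[|A m ×ˢ (Set.univ : Set Y)])) := by
  set B : M → Set (X × Y) := fun m => A m ×ˢ (Set.univ : Set Y) with hB
  have hBm : ∀ m, MeasurableSet (B m) := fun m => (hAmeas m).prod MeasurableSet.univ
  have hBd : Pairwise (Function.onFun Disjoint B) := fun i j hij =>
    Set.Disjoint.set_prod_left (hdisj hij) _ _
  have hBc : ⋃ m, B m = Set.univ := by
    rw [hB, ← Set.iUnion_prod_const, hcover, Set.univ_prod_univ]
  have hΦ : Measurable (fun q : X × Y => (g q.1, q.2)) := by fun_prop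
  set φ : Z × Y → ℝ := fun z => ℓ (h z.1, z.2) with hφdef
  have hφ : Measurable φ := by fun_prop
  have hφ0 : ∀ z, 0 ≤ φ z := fun z => (hℓ _ _).1
  have hφL : ∀ z, φ z ≤ L := fun z => (hℓ _ _).2
  have hF : Measurable (fun q : X × Y => ℓ (h (g q.1), q.2)) := hφ.comp hΦ
  have hFi : ∀ (ρ : Measure (X × Y)) [IsProbabilityMeasure ρ],
      Integrable (fun q : X × Y => ℓ (h (g q.1), q.2)) ρ := fun ρ _ =>
    (integrable_const L).mono' hF.aestronglyMeasurable (ae_of_all _ fun q => by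
      rw [Real.norm_of_nonneg (hℓ _ _).1]; exact (hℓ _ _).2)
  have hpμ : ∀ m, IsProbabilityMeasure (μ[|B m]) := fun m =>
    cond_isProbabilityMeasure (hμpos m).ne'
  have hpν : ∀ m, IsProbabilityMeasure (ν[|B m]) := fun m =>
    cond_isProbabilityMeasure (hνpos m).ne'
  have hsum : HasSum (fun m => (μ (B m)).toReal) 1 := by
    have h1 := hasSum_integral_iUnion (μ := μ) (f := fun _ => (1:ℝ)) hBm hBd
      (integrable_const _).integrableOn
    rw [hBc] at h1
    simpa [Measure.real] using h1
  have hint : HasSum (fun m => (μ (B m)).toReal * ∫ q, ℓ (h (g q.1), q.2) ∂(μ[|B m]))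
      (∫ q, ℓ (h (g q.1), q.2) ∂μ) := by
    have h1 := hasSum_integral_iUnion (μ := μ) (f := fun q : X × Y => ℓ (h (g q.1), q.2)) hBm hBd
      (hFi μ).integrableOn
    rw [hBc, setIntegral_univ] at h1
    refine (congrArg (fun F => HasSum F _) (funext fun m => ?_)).mpr h1
    unfold ProbabilityTheory.cond
    rw [ integral_smul_measure, smul_eq_mul, ENNReal.toReal_inv,
      mul_inv_cancel_left₀ (ENNReal.toReal_pos (hμpos m).ne' (measure_ne_top _ _)).ne']
  have fact : ∀ m, _ := fun m =>
    haveI := hpμ m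
    haveI := hpν m
    haveI : IsProbabilityMeasure (Measure.map (fun q : X × Y => (g q.1, q.2)) (μ[|B m])) :=
      Measure.isProbabilityMeasure_map hΦ.aemeasurable
    haveI : IsProbabilityMeasure (Measure.map (fun q : X × Y => (g q.1, q.2)) (ν[|B m])) :=
      Measure.isProbabilityMeasure_map hΦ.aemeasurable
    hell_facts (Measure.map (fun q : X × Y => (g q.1, q.2)) (μ[|B m]))
      (Measure.map (fun q : X × Y => (g q.1, q.2)) (ν[|B m])) φ hφ L hL hφ0 hφL
  have s1 : Summable (fun m => (μ (B m)).toReal * ∫ q, ℓ (h (g q.1), q.2) ∂(ν[|B m])) := by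
    refine Summable.of_nonneg_of_le (fun m => mul_nonneg ENNReal.toReal_nonneg
      (integral_nonneg fun q => (hℓ _ _).1)) (fun m => ?_) (hsum.summable.mul_right L)
    refine mul_le_mul_of_nonneg_left ?_ ENNReal.toReal_nonneg
    haveI := hpν m
    have := integral_mono (hFi (ν[|B m])) (integrable_const L) (fun q => (hℓ _ _).2)
    simpa using this
  have s2 : Summable (fun m => (μ (B m)).toReal * hellingerDist
      (Measure.map (fun q : X × Y => (g q.1, q.2)) (μ[|B m]))
      (Measure.map (fun q : X × Y => (g q.1, q.2)) (ν[|B m]))) :=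
    Summable.of_nonneg_of_le (fun m => mul_nonneg ENNReal.toReal_nonneg (Real.sqrt_nonneg _))
      (fun m => mul_le_mul_of_nonneg_left (fact m).2 ENNReal.toReal_nonneg)
      (hsum.summable.mul_right 2)
  refine hasSum_le (fun m => ?_) hint (s1.hasSum.add (s2.hasSum.mul_left (Real.sqrt 2 * L)))
  have k := (fact m).1
  rw [integral_map hΦ.aemeasurable hφ.aestronglyMeasurable,
    integral_map hΦ.aemeasurable hφ.aestronglyMeasurable] at k
  have k2 := mul_le_mul_of_nonneg_left k (ENNReal.toReal_nonneg (a := μ (B m)))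
  refine k2.trans (le_of_eq ?_)
  simp only [hφdef]
  ring
end
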